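/- Let k > 4 be an integer and let X₂ ⊆ ℝ³ be the second surface of Example 1. Then the germ at 0 of X₂ is ambient topologically equivalent to the germ at 0 of the straight cone over three disjoint circles C = {(x,y,t) : (x²+y²−4t²)·((x−t)²+(y−t/2)²−t²/16)·((x−t)²+(y+t/2)²−t²/16) = 0 and t ≥ 0}: there exist open neighborhoods U, V of 0 in ℝ³ and a homeomorphism h : U → V with h(0) = 0 and h(X₂ ∩ U) = C ∩ V. -/

import Mathlib

open Set Metric

noncomputable section

/-- The surface `X₁` of Example 1 in `ℝ³` (coordinates `x = p 0`, `y = p 1`, `t = p 2`). -/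
def ExampleX1 (k : ℕ) : Set (EuclideanSpace ℝ (Fin 3)) :=
  {p | ((p 0 ^ 2 - 2 * p 0 * p 2 + p 1 ^ 2) * (p 0 ^ 2 + 2 * p 0 * p 2 + p 1 ^ 2) - p 2 ^ k) *
        ((p 0 - p 2) ^ 2 + (p 1 - p 2 / 2) ^ 2 - p 2 ^ 2 / 16) *
        ((p 0 - p 2) ^ 2 + (p 1 + p 2 / 2) ^ 2 - p 2 ^ 2 / 16) = 0 ∧ 0 ≤ p 2}

/-- The surface `X₂` of Example 1 in `ℝ³`. -/
def ExampleX2 (k : ℕ) : Set (EuclideanSpace ℝ (Fin 3)) :=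
  {p | ((p 0 ^ 2 - 2 * p 0 * p 2 + p 1 ^ 2) * (p 0 ^ 2 + 2 * p 0 * p 2 + p 1 ^ 2) - p 2 ^ k) *
        ((p 0 - p 2) ^ 2 + p 1 ^ 2 - p 2 ^ 2 / 16) *
        ((p 0 + p 2) ^ 2 + p 1 ^ 2 - p 2 ^ 2 / 16) = 0 ∧ 0 ≤ p 2}

/-- The straight cone `C` over three disjoint circles in the plane `t = 1`, two of them
bounding non-intersecting discs inside the disc bounded by the third one. -/
def ConeC : Set (EuclideanSpace ℝ (Fin 3)) :=
  {p | (p 0 ^ 2 + p 1 ^ 2 - 4 * p 2 ^ 2) *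
        ((p 0 - p 2) ^ 2 + (p 1 - p 2 / 2) ^ 2 - p 2 ^ 2 / 16) *
        ((p 0 - p 2) ^ 2 + (p 1 + p 2 / 2) ^ 2 - p 2 ^ 2 / 16) = 0 ∧ 0 ≤ p 2}

/-- The germs at `0` of `X` and `Y` are ambient topologically equivalent: there exist open
neighborhoods `U, V` of `0` and a homeomorphism `h : U → V` (with continuous inverse `g`)
such that `h 0 = 0` and `h (X ∩ U) = Y ∩ V`. -/
def AmbientTopEquiv {n : ℕ} (X Y : Set (EuclideanSpace ℝ (Fin n))) : Prop :=
  ∃ U V : Set (EuclideanSpace ℝ (Fin n)), IsOpen U ∧ IsOpen V ∧ 0 ∈ U ∧ 0 ∈ V ∧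
    ∃ h g : EuclideanSpace ℝ (Fin n) → EuclideanSpace ℝ (Fin n),
      ContinuousOn h U ∧ ContinuousOn g V ∧
      Set.MapsTo h U V ∧ Set.MapsTo g V U ∧
      (∀ x ∈ U, g (h x) = x) ∧ (∀ y ∈ V, h (g y) = y) ∧
      h 0 = 0 ∧ h '' (X ∩ U) = Y ∩ V

/-- A trapezoidal bump of height at most `L`, supported in `[m, R]`. -/
def bump (L a b m R r : ℝ) : ℝ := max 0 (min L (min ((r - m) / a) ((R - r) / b)))

/-- Displacement of the real line by `d` times a bump. -/
def slide (d L a b m R r : ℝ) : ℝ := r + d * bump L a b m R r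

theorem bump_nonneg (L a b m R r : ℝ) : 0 ≤ bump L a b m R r := le_max_left _ _

theorem bump_eq_zero {L a b m R r : ℝ} (ha : 0 < a) (hb : 0 < b)
    (h : L ≤ 0 ∨ r ≤ m ∨ R ≤ r) : bump L a b m R r = 0 := by
  refine max_eq_left ?_
  rcases h with h | h | h
  · exact min_le_of_left_le h
  · exact min_le_of_right_le (min_le_of_left_le (div_nonpos_of_nonpos_of_nonneg (by linarith) ha.le))
  · exact min_le_of_right_le (min_le_of_right_le (div_nonpos_of_nonpos_of_nonneg (by linarith) hb.le))

theorem bump_eq_self {L a b m R r : ℝ} (ha : 0 < a) (hb : 0 < b) (hL : 0 ≤ L)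
    (hm : L * a ≤ r - m) (hR : L * b ≤ R - r) : bump L a b m R r = L := by
  rw [bump, min_eq_left (le_min ((le_div_iff₀ ha).2 hm) ((le_div_iff₀ hb).2 hR)), max_eq_right hL]

theorem bump_slide {d L a b m R : ℝ} (ha : 0 < a) (hb : 0 < b) (had : 0 < a + d)
    (hbd : 0 < b - d) (r : ℝ) :
    bump L (a + d) (b - d) m R (slide d L a b m R r) = bump L a b m R r := by
  set s := bump L a b m R r with hs
  have hA : (r + d * s - m) / (a + d) - s = a / (a + d) * ((r - m) / a - s) := by
    field_simp; ring
  have hB : (R - (r + d * s)) / (b - d) - s = b / (b - d) * ((R - r) / b - s) := by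
    field_simp; ring
  have hpa : 0 < a / (a + d) := div_pos ha had
  have hpb : 0 < b / (b - d) := div_pos hb hbd
  rw [slide, ← hs, bump]
  rw [bump] at hs
  generalize (r + d * s - m) / (a + d) = A' at *
  generalize (R - (r + d * s)) / (b - d) = B' at *
  generalize (r - m) / a = A at *
  generalize (R - r) / b = B at *
  have h1 : A' ≤ s ↔ A ≤ s := by
    rw [← sub_nonpos, hA, mul_nonpos_iff_pos_imp_nonpos]
    constructor
    · intro h; linarith [h.1 hpa]
    · intro h; exact ⟨fun _ => by linarith, fun h' => hpa.le⟩
  have h2 : B' ≤ s ↔ B ≤ s := by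
    rw [← sub_nonpos, hB, mul_nonpos_iff_pos_imp_nonpos]
    constructor
    · intro h; linarith [h.1 hpb]
    · intro h; exact ⟨fun _ => by linarith, fun h' => hpb.le⟩
  have h3 : s ≤ A' ↔ s ≤ A := by
    rw [← sub_nonneg, hA, mul_nonneg_iff_of_pos_left hpa, sub_nonneg]
  have h4 : s ≤ B' ↔ s ≤ B := by
    rw [← sub_nonneg, hB, mul_nonneg_iff_of_pos_left hpb, sub_nonneg]
  clear hA hB hpa hpb
  grind

theorem slide_slide {d L a b m R : ℝ} (ha : 0 < a) (hb : 0 < b) (had : 0 < a + d)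
    (hbd : 0 < b - d) (r : ℝ) :
    slide (-d) L (a + d) (b - d) m R (slide d L a b m R r) = r := by
  rw [slide, bump_slide ha hb had hbd, slide]
  ring

/-- The cone over the circle of centre `w` and radius `r` in the plane `t = 1`. -/
def circleCone (w : ℂ) (r : ℝ) : Set (ℂ × ℝ) := {p | 0 ≤ p.2 ∧ ‖p.1 - p.2 • w‖ = r * p.2}

/-- The height of the strip around `g = c t` in which `shear` acts. -/
def cap (g : ℂ →L[ℝ] ℝ) (c : ℝ) (p : ℂ × ℝ) : ℝ := min p.2 (2 * p.2 - 4 * |g p.1 - c * p.2|)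

/-- The homeomorphism of `ℂ × ℝ` sliding points in direction `v` by `d t`, cut off to a
conical neighbourhood of the half-plane `g = c t`. -/
def shear (v : ℂ) (f g : ℂ →L[ℝ] ℝ) (hf : f v = 1) (hg : g v = 0) (c M d a b : ℝ)
    (ha : 0 < a) (hb : 0 < b) (had : 0 < a + d) (hbd : 0 < b - d) :
    (ℂ × ℝ) ≃ₜ (ℂ × ℝ) where
  toFun p := (p.1 + (d * bump (cap g c p) a b (-(M * p.2)) (M * p.2) (f p.1)) • v, p.2)
  invFun p := (p.1 + (-d * bump (cap g c p) (a + d) (b - d) (-(M * p.2)) (M * p.2) (f p.1)) • v,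
    p.2)
  left_inv p := by
    have := bump_slide (L := cap g c p) (m := -(M * p.2)) (R := M * p.2) ha hb had hbd (f p.1)
    rw [slide, cap] at this
    simp only [cap, map_add, map_smul, hf, hg, smul_eq_mul, mul_one, mul_zero, add_zero, this]
    ext1 <;> simp
  right_inv p := by
    have := bump_slide (L := cap g c p) (m := -(M * p.2)) (R := M * p.2) (d := -d) had hbd
      (by linarith) (by linarith) (f p.1)
    rw [slide, add_neg_cancel_right, sub_neg_eq_add, sub_add_cancel, cap] at this
    simp only [cap, map_add, map_smul, hf, hg, smul_eq_mul, mul_one, mul_zero, add_zero, this]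
    ext1 <;> simp
  continuous_toFun := by unfold bump cap; fun_prop
  continuous_invFun := by unfold bump cap; fun_prop

section shear

variable {v : ℂ} {f g : ℂ →L[ℝ] ℝ} {hf : f v = 1} {hg : g v = 0} {c M d a b : ℝ}
  {ha : 0 < a} {hb : 0 < b} {had : 0 < a + d} {hbd : 0 < b - d}

theorem shear_apply (p : ℂ × ℝ) : shear v f g hf hg c M d a b ha hb had hbd p =
    (p.1 + (d * bump (cap g c p) a b (-(M * p.2)) (M * p.2) (f p.1)) • v, p.2) := rfl

theorem shear_zero : shear v f g hf hg c M d a b ha hb had hbd 0 = 0 := by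
  simp [shear_apply, bump, cap]

theorem shear_image_eq_self {A : Set (ℂ × ℝ)}
    (hA : ∀ p ∈ A, cap g c p ≤ 0 ∨ f p.1 ≤ -(M * p.2) ∨ M * p.2 ≤ f p.1) :
    shear v f g hf hg c M d a b ha hb had hbd '' A = A := by
  refine (Set.image_congr fun p hp => ?_).trans (image_id A)
  simp [shear_apply, bump_eq_zero ha hb (hA p hp)]

/-- A shear supported inside the cone of radius `2` leaves that cone invariant. -/
theorem shear_image_outer (hfg : ∀ z, ‖z‖ ^ 2 = f z ^ 2 + g z ^ 2)
    (hcM : (|c| + 1 / 2) ^ 2 + M ^ 2 ≤ 4) :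
    shear v f g hf hg c M d a b ha hb had hbd '' circleCone 0 2 = circleCone 0 2 := by
  refine shear_image_eq_self fun p ⟨ht, hp⟩ => ?_
  by_contra! h
  obtain ⟨h0, h1, h2⟩ := h
  have hcap := lt_min_iff.1 h0
  have hz := hfg p.1
  rw [smul_zero, sub_zero] at hp
  have h3 : |g p.1| < (|c| + 1 / 2) * p.2 := by
    have := abs_add_le (g p.1 - c * p.2) (c * p.2)
    rw [sub_add_cancel, abs_mul, abs_of_nonneg ht] at this
    linarith
  have h4 : g p.1 ^ 2 < ((|c| + 1 / 2) * p.2) ^ 2 := sq_lt_sq.2 (h3.trans_le (le_abs_self _))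
  have h5 : f p.1 ^ 2 < (M * p.2) ^ 2 := sq_lt_sq' h1 h2
  rw [hp] at hz
  nlinarith [sq_nonneg p.2]

theorem abs_le_of_mem_circleCone (hfg : ∀ z, ‖z‖ ^ 2 = f z ^ 2 + g z ^ 2) {w : ℂ} {r : ℝ}
    {p : ℂ × ℝ} (hp : p ∈ circleCone w r) :
    |f p.1 - p.2 * f w| ≤ r * p.2 ∧ |g p.1 - p.2 * g w| ≤ r * p.2 := by
  have h := hfg (p.1 - p.2 • w)
  have h0 := norm_nonneg (p.1 - p.2 • w)
  rw [hp.2] at h h0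
  simp only [map_sub, map_smul, smul_eq_mul] at h
  exact ⟨abs_le_of_sq_le_sq (by nlinarith [sq_nonneg (g p.1 - p.2 * g w)]) h0,
    abs_le_of_sq_le_sq (by nlinarith [sq_nonneg (f p.1 - p.2 * f w)]) h0⟩

theorem shear_image_far (hfg : ∀ z, ‖z‖ ^ 2 = f z ^ 2 + g z ^ 2) {w : ℂ}
    (hw : 3 / 4 ≤ |g w - c|) :
    shear v f g hf hg c M d a b ha hb had hbd '' circleCone w (1 / 4) =
      circleCone w (1 / 4) := by
  refine shear_image_eq_self fun p hp => Or.inl (min_le_of_right_le ?_)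
  have h1 := (abs_le_of_mem_circleCone hfg hp).2
  have h2 := abs_sub_abs_le_abs_sub (p.2 * g w - p.2 * c) (p.2 * g w - g p.1)
  have h3 := hp.1
  rw [← mul_sub, abs_mul, abs_of_nonneg h3, abs_sub_comm (p.2 * g w)] at h2
  have h4 : p.2 * (g w - c) - (p.2 * g w - g p.1) = g p.1 - c * p.2 := by ring
  rw [h4] at h2
  nlinarith

/-- A shear translates a circle which lies in the plateau of its cut-off. -/
theorem shear_image_near (hfg : ∀ z, ‖z‖ ^ 2 = f z ^ 2 + g z ^ 2) {w w' : ℂ}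
    (hw : g w = c) (hw' : w' = w + d • v) (hwa : a ≤ M + f w - 1 / 4)
    (hwb : b ≤ M - f w - 1 / 4) :
    shear v f g hf hg c M d a b ha hb had hbd '' circleCone w (1 / 4) =
      circleCone w' (1 / 4) := by
  have key : ∀ p ∈ circleCone w (1 / 4),
      shear v f g hf hg c M d a b ha hb had hbd p = (p.1 + p.2 • d • v, p.2) := by
    intro p hp
    have ht := hp.1
    obtain ⟨h1, h2⟩ := abs_le_of_mem_circleCone hfg hp
    have hcap : cap g c p = p.2 := by
      refine min_eq_left ?_
      rw [hw, mul_comm] at h2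
      linarith
    have h1' := abs_le.1 h1
    rw [shear_apply, hcap, bump_eq_self ha hb ht (by nlinarith) (by nlinarith), mul_comm,
      mul_smul]
  rw [Set.image_congr key]
  ext q
  constructor
  · rintro ⟨p, ⟨ht, hp⟩, rfl⟩
    refine ⟨ht, ?_⟩
    rw [← hp, hw']
    simp only [smul_add]
    congr 1
    abel
  · rintro ⟨ht, hq⟩
    refine ⟨(q.1 - q.2 • d • v, q.2), ⟨ht, ?_⟩, by simp⟩
    rw [← hq, hw']
    simp only [smul_add]
    congr 1
    abel

end shear

/-- Three shears move two circles on the real axis to two circles in the half-plane `re > 0`. -/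
theorem exists_homeomorph_move_circles : ∃ H : (ℂ × ℝ) ≃ₜ (ℂ × ℝ), H 0 = 0 ∧
    H '' circleCone 0 2 = circleCone 0 2 ∧
    H '' circleCone 1 (1 / 4) = circleCone ⟨1, 1 / 2⟩ (1 / 4) ∧
    H '' circleCone (-1) (1 / 4) = circleCone ⟨1, -1 / 2⟩ (1 / 4) := by
  have hri : ∀ z : ℂ, ‖z‖ ^ 2 = Complex.reCLM z ^ 2 + Complex.imCLM z ^ 2 := fun z => by
    rw [Complex.sq_norm, Complex.normSq_apply, Complex.reCLM_apply, Complex.imCLM_apply]; ring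
  have hir : ∀ z : ℂ, ‖z‖ ^ 2 = Complex.imCLM z ^ 2 + Complex.reCLM z ^ 2 := fun z => by
    rw [hri, add_comm]
  let H₁ := shear Complex.I Complex.imCLM Complex.reCLM (by simp) (by simp) 1 (5 / 4) (1 / 2) 1 1
    (by norm_num) (by norm_num) (by norm_num) (by norm_num)
  let H₂ := shear Complex.I Complex.imCLM Complex.reCLM (by simp) (by simp) (-1) (5 / 4) (-1 / 2)
    1 1 (by norm_num) (by norm_num) (by norm_num) (by norm_num)
  let H₃ := shear 1 Complex.reCLM Complex.imCLM (by simp) (by simp) (-1 / 2) (3 / 2) 2 (1 / 4)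
    (9 / 4) (by norm_num) (by norm_num) (by norm_num) (by norm_num)
  have htrans (A : Set (ℂ × ℝ)) : ((H₁.trans H₂).trans H₃) '' A = H₃ '' (H₂ '' (H₁ '' A)) := by
    rw [image_image, image_image]
    rfl
  refine ⟨(H₁.trans H₂).trans H₃, ?_, ?_, ?_, ?_⟩
  · have h₁ : H₁ 0 = 0 := shear_zero
    have h₂ : H₂ 0 = 0 := shear_zero
    have h₃ : H₃ 0 = 0 := shear_zero
    rw [Homeomorph.trans_apply, Homeomorph.trans_apply, h₁, h₂, h₃]
  · rw [htrans,
      show H₁ '' circleCone 0 2 = _ from shear_image_outer hir (by norm_num),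
      show H₂ '' circleCone 0 2 = _ from shear_image_outer hir (by norm_num),
      show H₃ '' circleCone 0 2 = _ from shear_image_outer hri (by norm_num [abs_of_pos])]
  · rw [htrans,
      show H₁ '' circleCone 1 (1 / 4) = circleCone ⟨1, 1 / 2⟩ (1 / 4) from
        shear_image_near hir (by simp) (Complex.ext (by simp) (by simp)) (by norm_num)
          (by norm_num),
      show H₂ '' circleCone ⟨1, 1 / 2⟩ (1 / 4) = _ from shear_image_far hir (by norm_num),
      show H₃ '' circleCone ⟨1, 1 / 2⟩ (1 / 4) = _ from shear_image_far hri (by norm_num)]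
  · rw [htrans,
      show H₁ '' circleCone (-1) (1 / 4) = _ from shear_image_far hir (by norm_num),
      show H₂ '' circleCone (-1) (1 / 4) = circleCone ⟨-1, -1 / 2⟩ (1 / 4) from
        shear_image_near hir (by simp) (Complex.ext (by simp) (by simp)) (by norm_num)
          (by norm_num),
      show H₃ '' circleCone ⟨-1, -1 / 2⟩ (1 / 4) = circleCone ⟨1, -1 / 2⟩ (1 / 4) from
        shear_image_near hri (by simp) (Complex.ext (by norm_num) (by norm_num)) (by norm_num)
          (by norm_num)]

/-- The piecewise linear map of the half-line which sends `b` to `c` and is the identity near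
`0` and near infinity. -/
def stretch (b c r : ℝ) : ℝ :=
  slide (c - b) 1 (b - 7 / 10 * min b c) c (7 / 10 * min b c) (b + c) r

section stretch

variable {b c r : ℝ}

theorem stretch_self (b r : ℝ) : stretch b b r = r := by simp [stretch, slide]

theorem seven_tenths_min_lt_left (hb : 0 < b) : 7 / 10 * min b c < b := by
  linarith [min_le_left b c]

theorem seven_tenths_min_lt_right (hc : 0 < c) : 7 / 10 * min b c < c := by
  linarith [min_le_right b c]

theorem stretch_stretch (hb : 0 < b) (hc : 0 < c) (r : ℝ) :
    stretch c b (stretch b c r) = r := by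
  have h1 := seven_tenths_min_lt_left (c := c) hb
  have h2 := seven_tenths_min_lt_right (b := b) hc
  have := slide_slide (d := c - b) (L := 1) (m := 7 / 10 * min b c) (R := b + c)
    (sub_pos.2 h1) hc (by linarith) (by linarith) r
  refine Eq.trans ?_ this
  unfold stretch
  rw [min_comm c b, add_comm c b]
  congr 1 <;> ring

theorem stretch_of_le (hb : 0 < b) (hc : 0 < c) (hr : r ≤ 7 / 10 * min b c) :
    stretch b c r = r := by
  rw [stretch, slide, bump_eq_zero (sub_pos.2 (seven_tenths_min_lt_left hb)) hc
    (Or.inr (Or.inl hr)), mul_zero, add_zero]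

theorem stretch_left (hb : 0 < b) (hc : 0 < c) : stretch b c b = c := by
  rw [stretch, slide, bump_eq_self (sub_pos.2 (seven_tenths_min_lt_left hb)) hc zero_le_one
    (by simp) (by simp)]
  ring

theorem stretch_pos (hb : 0 < b) (hc : 0 < c) (hr : 0 < r) : 0 < stretch b c r := by
  have h1 := seven_tenths_min_lt_left (c := c) hb
  have h2 := seven_tenths_min_lt_right (b := b) hc
  rcases le_or_gt r (7 / 10 * min b c) with h | h
  · rwa [stretch_of_le hb hc h]
  have hm : 0 < 7 / 10 * min b c := by positivity
  unfold stretch slide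
  generalize 7 / 10 * min b c = m at *
  have h0 := bump_nonneg 1 (b - m) c m (b + c) r
  rcases le_total b c with hbc | hbc
  · nlinarith
  have hs : bump 1 (b - m) c m (b + c) r ≤ (r - m) / (b - m) :=
    max_le (div_nonneg (by linarith) (by linarith))
      ((min_le_right _ _).trans (min_le_left _ _))
  have : (b - c) * ((r - m) / (b - m)) ≤ r - m := by
    rw [mul_div_assoc', div_le_iff₀ (by linarith)]
    nlinarith
  nlinarith

theorem abs_stretch_sub_le (b c r : ℝ) : |stretch b c r - r| ≤ |c - b| := by
  rw [stretch, slide, add_sub_cancel_left, abs_mul, abs_of_nonneg (bump_nonneg ..)]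
  exact mul_le_of_le_one_right (abs_nonneg _) (max_le zero_le_one (min_le_left _ _))

end stretch

/-- A family of star-shaped curves around the `t`-axis, `b p` being the radius in the direction
of `p` at the height of `p`. -/
structure IsRadius (b : ℂ × ℝ → ℝ) : Prop where
  smul : ∀ (p : ℂ × ℝ) (s : ℝ), 0 < s → b (s • p.1, p.2) = b p
  eq_zero : ∀ p : ℂ × ℝ, p.2 ≤ 0 → b p = 0
  lower : ∃ l : ℝ → ℝ, Continuous l ∧ ∀ p : ℂ × ℝ, 0 < p.2 → 0 < l p.2 ∧ l p.2 ≤ b p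
  upper : ∃ u : ℝ → ℝ, Continuous u ∧ (∀ t ≤ 0, u t = 0) ∧ ∀ p, b p ≤ u p.2
  continuousAt : ∀ p : ℂ × ℝ, p.1 ≠ 0 → ContinuousAt b p

/-- The radial map with profile `stretch`. -/
def radialMap (b c : ℂ × ℝ → ℝ) (p : ℂ × ℝ) : ℂ × ℝ :=
  ((stretch (b p) (c p) ‖p.1‖ / ‖p.1‖) • p.1, p.2)

section radial

variable {b c : ℂ × ℝ → ℝ}

theorem IsRadius.pos (hb : IsRadius b) {p : ℂ × ℝ} (hp : 0 < p.2) : 0 < b p := by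
  obtain ⟨l, -, hl⟩ := hb.lower
  exact (hl p hp).1.trans_le (hl p hp).2

theorem IsRadius.nonneg (hb : IsRadius b) (p : ℂ × ℝ) : 0 ≤ b p := by
  rcases le_or_gt p.2 0 with h | h
  · rw [hb.eq_zero p h]
  · exact (hb.pos h).le

theorem radialMap_eq_self {p : ℂ × ℝ} (h : stretch (b p) (c p) ‖p.1‖ = ‖p.1‖) :
    radialMap b c p = p := by
  rcases eq_or_ne p.1 0 with hz | hz
  · rw [radialMap, hz, smul_zero, ← hz]
  · rw [radialMap, h, div_self (norm_ne_zero_iff.2 hz), one_smul]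

theorem radialMap_of_nonpos (hb : IsRadius b) (hc : IsRadius c) {p : ℂ × ℝ} (hp : p.2 ≤ 0) :
    radialMap b c p = p :=
  radialMap_eq_self (by rw [hb.eq_zero p hp, hc.eq_zero p hp, stretch_self])

theorem norm_radialMap (hb : IsRadius b) (hc : IsRadius c) {p : ℂ × ℝ} (hz : p.1 ≠ 0)
    (hp : 0 < p.2) : ‖(radialMap b c p).1‖ = stretch (b p) (c p) ‖p.1‖ := by
  have hn := norm_pos_iff.2 hz
  rw [radialMap, norm_smul, norm_div, norm_norm, div_mul_cancel₀ _ hn.ne', Real.norm_eq_abs,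
    abs_of_pos (stretch_pos (hb.pos hp) (hc.pos hp) hn)]

theorem IsRadius.apply_radialMap {a : ℂ × ℝ → ℝ} (ha : IsRadius a) (hb : IsRadius b)
    (hc : IsRadius c) (p : ℂ × ℝ) : a (radialMap b c p) = a p := by
  rcases le_or_gt p.2 0 with hp | hp
  · rw [radialMap_of_nonpos hb hc hp]
  rcases eq_or_ne p.1 0 with hz | hz
  · rw [radialMap, hz, smul_zero, ← hz]
  · have hn := norm_pos_iff.2 hz
    exact ha.smul p _ (div_pos (stretch_pos (hb.pos hp) (hc.pos hp) hn) hn)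

theorem radialMap_radialMap (hb : IsRadius b) (hc : IsRadius c) (p : ℂ × ℝ) :
    radialMap c b (radialMap b c p) = p := by
  rcases le_or_gt p.2 0 with hp | hp
  · rw [radialMap_of_nonpos hb hc hp, radialMap_of_nonpos hc hb hp]
  rcases eq_or_ne p.1 0 with hz | hz
  · simp only [radialMap, hz, smul_zero]
    ext1 <;> simp [hz]
  have hn := norm_pos_iff.2 hz
  have hs := stretch_pos (hb.pos hp) (hc.pos hp) hn
  rw [radialMap, norm_radialMap hb hc hz hp, hb.apply_radialMap hb hc, hc.apply_radialMap hb hc,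
    stretch_stretch (hb.pos hp) (hc.pos hp)]
  simp only [radialMap, smul_smul]
  rw [div_mul_div_cancel₀ hs.ne', div_self hn.ne', one_smul]

theorem continuous_radialMap (hb : IsRadius b) (hc : IsRadius c) :
    Continuous (radialMap b c) := by
  refine continuous_iff_continuousAt.2 fun p => ?_
  rcases le_or_gt p.2 0 with hp | hp
  · obtain ⟨u, hu, hu0, hub⟩ := hb.upper
    obtain ⟨w, hw, hw0, hwc⟩ := hc.upper
    refine ContinuousAt.prodMk ?_ continuousAt_snd
    rw [ContinuousAt, hb.eq_zero p hp, hc.eq_zero p hp, stretch_self]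
    have hlim : Filter.Tendsto
        (fun q : ℂ × ℝ => (stretch (b q) (c q) ‖q.1‖ / ‖q.1‖) • q.1 - q.1) (nhds p) (nhds 0) := by
      refine squeeze_zero_norm (a := fun q : ℂ × ℝ => u q.2 + w q.2) (fun q => ?_) ?_
      · have h1 : |c q - b q| ≤ u q.2 + w q.2 := by
          have := hub q
          have := hwc q
          have := hb.nonneg q
          have := hc.nonneg q
          exact abs_le.2 ⟨by linarith, by linarith⟩
        refine le_trans ?_ h1
        rcases eq_or_ne q.1 0 with hz | hz
        · simp [hz]
        · have hn := norm_pos_iff.2 hz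
          have : (stretch (b q) (c q) ‖q.1‖ / ‖q.1‖) • q.1 - q.1 =
              ((stretch (b q) (c q) ‖q.1‖ - ‖q.1‖) / ‖q.1‖) • q.1 := by
            rw [sub_div, div_self hn.ne', sub_smul, one_smul]
          rw [this, norm_smul, norm_div, norm_norm, div_mul_cancel₀ _ hn.ne']
          exact abs_stretch_sub_le _ _ _
      · have : Continuous fun q : ℂ × ℝ => u q.2 + w q.2 := by fun_prop
        simpa [hu0 p.2 hp, hw0 p.2 hp] using this.tendsto p
    have h0 : (‖p.1‖ / ‖p.1‖) • p.1 = p.1 := by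
      rcases eq_or_ne p.1 0 with hz | hz
      · simp [hz]
      · rw [div_self (norm_ne_zero_iff.2 hz), one_smul]
    rw [h0]
    simpa using hlim.add (continuous_fst.tendsto p)
  rcases eq_or_ne p.1 0 with hz | hz
  · obtain ⟨l, hl, hlb⟩ := hb.lower
    obtain ⟨k, hk, hkc⟩ := hc.lower
    refine continuousAt_id.congr ?_
    have h1 : ∀ᶠ q in nhds p, 0 < q.2 := continuousAt_snd.eventually_const_lt hp
    have h2 : ∀ᶠ q : ℂ × ℝ in nhds p, ‖q.1‖ < 7 / 10 * min (l q.2) (k q.2) := by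
      refine ContinuousAt.eventually_lt (by fun_prop) (by fun_prop) ?_
      have h3 := (hlb p hp).1
      have h4 := (hkc p hp).1
      rw [hz, norm_zero]
      positivity
    filter_upwards [h1, h2] with q hq hq'
    refine (radialMap_eq_self (stretch_of_le (hb.pos hq) (hc.pos hq) (hq'.le.trans ?_))).symm
    gcongr
    exacts [(hlb q hq).2, (hkc q hq).2]
  · have hn := norm_ne_zero_iff.2 hz
    have hb' := hb.continuousAt p hz
    have hc' := hc.continuousAt p hz
    have h1 := (sub_pos.2 (seven_tenths_min_lt_left (c := c p) (hb.pos hp))).ne'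
    have h2 := (hc.pos hp).ne'
    unfold radialMap stretch slide bump
    fun_prop (disch := assumption)

/-- The homeomorphism carrying the family of curves `b` to the family of curves `c`. -/
def radialHomeomorph (hb : IsRadius b) (hc : IsRadius c) : (ℂ × ℝ) ≃ₜ (ℂ × ℝ) where
  toFun := radialMap b c
  invFun := radialMap c b
  left_inv := radialMap_radialMap hb hc
  right_inv := radialMap_radialMap hc hb
  continuous_toFun := continuous_radialMap hb hc
  continuous_invFun := continuous_radialMap hc hb

theorem mapsTo_radialMap (hb : IsRadius b) (hc : IsRadius c) :
    MapsTo (radialMap b c) {p | 0 ≤ p.2 ∧ ‖p.1‖ = b p} {p | 0 ≤ p.2 ∧ ‖p.1‖ = c p} := by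
  rintro p ⟨ht, hp⟩
  refine ⟨ht, ?_⟩
  rw [hc.apply_radialMap hb hc]
  rcases ht.eq_or_lt' with h0 | h0
  · rw [radialMap_of_nonpos hb hc h0.le, hp, hb.eq_zero p h0.le, hc.eq_zero p h0.le]
  · have hz : p.1 ≠ 0 := norm_pos_iff.1 (hp ▸ hb.pos h0)
    rw [norm_radialMap hb hc hz h0, hp, stretch_left (hb.pos h0) (hc.pos h0)]

theorem radialHomeomorph_image (hb : IsRadius b) (hc : IsRadius c) :
    radialHomeomorph hb hc '' {p | 0 ≤ p.2 ∧ ‖p.1‖ = b p} = {p | 0 ≤ p.2 ∧ ‖p.1‖ = c p} := by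
  refine (mapsTo_radialMap hb hc).image_subset.antisymm fun p hp => ?_
  exact ⟨radialMap c b p, mapsTo_radialMap hc hb hp, radialMap_radialMap hc hb p⟩

end radial

/-- The radius of the straight cone. -/
def coneRadius (p : ℂ × ℝ) : ℝ := 2 * max p.2 0

/-- The radius of the peanut `‖z‖ ^ 4 = 4 t ^ 2 (re z) ^ 2 + t ^ k`. -/
def peanutRadius (k : ℕ) (p : ℂ × ℝ) : ℝ :=
  √(2 * max p.2 0 ^ 2 * (p.1.re / ‖p.1‖) ^ 2 +
    √((2 * max p.2 0 ^ 2 * (p.1.re / ‖p.1‖) ^ 2) ^ 2 + max p.2 0 ^ k))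

theorem isRadius_coneRadius : IsRadius coneRadius where
  smul _ _ _ := rfl
  eq_zero p hp := by simp [coneRadius, hp]
  lower := ⟨fun t => 2 * max t 0, by fun_prop, fun p hp => ⟨by positivity, le_rfl⟩⟩
  upper := ⟨fun t => 2 * max t 0, by fun_prop, fun t ht => by simp [ht], fun p => le_rfl⟩
  continuousAt p _ := by unfold coneRadius; fun_prop

theorem re_div_norm_sq_le_one (z : ℂ) : (z.re / ‖z‖) ^ 2 ≤ 1 := by
  rw [sq_le_one_iff_abs_le_one, abs_div, abs_norm]
  exact div_le_one_of_le₀ (Complex.abs_re_le_norm z) (norm_nonneg z)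

theorem isRadius_peanutRadius {k : ℕ} (hk : k ≠ 0) : IsRadius (peanutRadius k) where
  smul p s hs := by
    unfold peanutRadius
    rw [Complex.smul_re, norm_smul, Real.norm_of_nonneg hs.le, smul_eq_mul,
      mul_div_mul_left _ _ hs.ne']
  eq_zero p hp := by simp [peanutRadius, hp, hk]
  lower := by
    refine ⟨fun t => √√(max t 0 ^ k), by fun_prop, fun p hp => ⟨by positivity, ?_⟩⟩
    refine Real.sqrt_le_sqrt (le_add_of_nonneg_of_le (by positivity) (Real.sqrt_le_sqrt ?_))
    exact le_add_of_nonneg_left (by positivity)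
  upper := by
    refine ⟨fun t => √(2 * max t 0 ^ 2 * 1 + √((2 * max t 0 ^ 2 * 1) ^ 2 + max t 0 ^ k)),
      by fun_prop, fun t ht => by simp [ht, hk], fun p => ?_⟩
    have := re_div_norm_sq_le_one p.1
    unfold peanutRadius
    beta_reduce
    gcongr
  continuousAt p hp := by
    have hn := norm_ne_zero_iff.2 hp
    unfold peanutRadius
    fun_prop (disch := assumption)

theorem sq_norm_mul_re_div_norm_sq (z : ℂ) : ‖z‖ ^ 2 * (z.re / ‖z‖) ^ 2 = z.re ^ 2 := by
  rcases eq_or_ne z 0 with rfl | hz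
  · simp
  · have := norm_ne_zero_iff.2 hz
    field_simp

theorem norm_eq_peanutRadius_iff {k : ℕ} {p : ℂ × ℝ} (hp : 0 ≤ p.2) :
    ‖p.1‖ = peanutRadius k p ↔ ‖p.1‖ ^ 4 - 4 * p.1.re ^ 2 * p.2 ^ 2 = p.2 ^ k := by
  have hq := sq_norm_mul_re_div_norm_sq p.1
  have hn := norm_nonneg p.1
  have ht : 0 ≤ p.2 ^ k := pow_nonneg hp k
  rw [peanutRadius, max_eq_left hp, eq_comm, Real.sqrt_eq_iff_eq_sq (by positivity) hn,
    ← eq_sub_iff_add_eq']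
  have hq0 : p.1 = 0 → (p.1.re / ‖p.1‖) ^ 2 = 0 := fun h => by simp [h]
  set q := (p.1.re / ‖p.1‖) ^ 2
  have hq1 : 0 ≤ q := sq_nonneg _
  constructor
  · intro h
    have h2 := Real.sq_sqrt (show 0 ≤ (2 * p.2 ^ 2 * q) ^ 2 + p.2 ^ k by positivity)
    rw [h] at h2
    rw [← hq]
    linear_combination h2
  · intro h
    rw [← hq] at h
    have h3 : (‖p.1‖ ^ 2 - 2 * p.2 ^ 2 * q) ^ 2 = (2 * p.2 ^ 2 * q) ^ 2 + p.2 ^ k := by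
      linear_combination h
    rw [← h3, Real.sqrt_sq]
    by_contra! hneg
    rcases eq_or_ne p.1 0 with hz | hz
    · rw [hq0 hz, hz] at hneg
      simp at hneg
    · have : 0 < ‖p.1‖ ^ 2 := by positivity
      nlinarith

/-- The two inner cones lie in the region near the axis which the radial map fixes. -/
theorem radialHomeomorph_image_inner {k : ℕ} (hk : k ≠ 0) {w : ℝ} (hw : w ^ 2 = 1) :
    radialHomeomorph (isRadius_peanutRadius hk) isRadius_coneRadius ''
      circleCone (w : ℂ) (1 / 4) = circleCone (w : ℂ) (1 / 4) := by
  refine (Set.image_congr fun p hp => ?_).trans (image_id _)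
  refine radialMap_eq_self (c := coneRadius) ?_
  obtain ⟨ht, hp⟩ := hp
  have hn := norm_nonneg p.1
  have h1 : ‖p.1‖ ^ 2 = p.1.re ^ 2 + p.1.im ^ 2 := by
    rw [Complex.sq_norm, Complex.normSq_apply]; ring
  have h2 : (p.1.re - p.2 * w) ^ 2 + p.1.im ^ 2 = p.2 ^ 2 / 16 := by
    have := congrArg (· ^ 2) hp
    simp only [Complex.sq_norm, Complex.normSq_apply] at this
    simp at this
    linear_combination this
  rcases ht.eq_or_lt' with h0 | h0
  · rw [(isRadius_peanutRadius hk).eq_zero p h0.le, isRadius_coneRadius.eq_zero p h0.le,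
      stretch_self]
  refine stretch_of_le ((isRadius_peanutRadius hk).pos h0) (isRadius_coneRadius.pos h0) ?_
  have h3 : p.1.re * w ≤ 5 / 4 * p.2 := by
    nlinarith [sq_nonneg (p.1.im), sq_nonneg (p.1.re * w - p.2)]
  have h4 : ‖p.1‖ ^ 2 = 2 * p.2 * (p.1.re * w) - 15 / 16 * p.2 ^ 2 := by
    linear_combination h1 + h2 - p.2 ^ 2 * hw
  have h5 : ‖p.1‖ ≤ 5 / 4 * p.2 := by
    refine abs_le_of_sq_le_sq' ?_ (by positivity) |>.2
    nlinarith
  have h6 : ‖p.1‖ ^ 2 ≤ 7 / 5 * p.2 * (p.1.re * w) := by nlinarith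
  have hq := sq_norm_mul_re_div_norm_sq p.1
  have h7 : ‖p.1‖ ^ 2 ≤ (7 / 5 * p.2) ^ 2 * (p.1.re / ‖p.1‖) ^ 2 := by
    have h8 : (‖p.1‖ ^ 2) ^ 2 ≤ (7 / 5 * p.2 * (p.1.re * w)) ^ 2 :=
      pow_le_pow_left₀ (sq_nonneg _) h6 2
    rcases eq_or_ne p.1 0 with hz | hz
    · simp [hz]
    · have : 0 < ‖p.1‖ ^ 2 := by positivity
      refine le_of_mul_le_mul_left ?_ this
      calc ‖p.1‖ ^ 2 * ‖p.1‖ ^ 2 ≤ (7 / 5 * p.2 * (p.1.re * w)) ^ 2 := by rw [← sq]; exact h8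
        _ = _ := by linear_combination (7 / 5 * p.2) ^ 2 * (p.1.re ^ 2 * hw - hq)
  have h9 : 2 * p.2 * |p.1.re / ‖p.1‖| ≤ peanutRadius k p := by
    refine Real.le_sqrt_of_sq_le ?_
    rw [max_eq_left ht, mul_pow, sq_abs]
    have : 2 * p.2 ^ 2 * (p.1.re / ‖p.1‖) ^ 2 ≤
        √((2 * p.2 ^ 2 * (p.1.re / ‖p.1‖) ^ 2) ^ 2 + p.2 ^ k) :=
      Real.le_sqrt_of_sq_le (le_add_of_nonneg_right (by positivity))
    linarith
  have h10 : ‖p.1‖ ≤ 7 / 5 * p.2 * |p.1.re / ‖p.1‖| := by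
    refine abs_le_of_sq_le_sq' ?_ (by positivity) |>.2
    rwa [mul_pow, sq_abs]
  rw [mul_min_of_nonneg _ _ (by norm_num)]
  refine le_min (by linarith) ?_
  rw [coneRadius, max_eq_left ht]
  linarith

/-- Euclidean three-space as the product of the complex `(x, y)`-plane and the `t`-line. -/
def complexProdReal : EuclideanSpace ℝ (Fin 3) ≃ₜ ℂ × ℝ where
  toFun p := (⟨p 0, p 1⟩, p 2)
  invFun q := !₂[q.1.re, q.1.im, q.2]
  left_inv p := by ext i; fin_cases i <;> rfl
  right_inv q := rfl
  continuous_toFun := by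
    have : (fun p : EuclideanSpace ℝ (Fin 3) => ((⟨p 0, p 1⟩ : ℂ), p 2)) =
        fun p => ((p 0 : ℂ) + (p 1 : ℂ) * Complex.I, p 2) := by
      funext p
      rw [← Complex.mk_eq_add_mul_I]
    rw [this]
    fun_prop
  continuous_invFun := by
    refine (PiLp.continuous_toLp 2 _).comp (continuous_pi fun i => ?_)
    fin_cases i
    · exact Complex.continuous_re.comp continuous_fst
    · exact Complex.continuous_im.comp continuous_fst
    · exact continuous_snd

theorem complexProdReal_apply (p : EuclideanSpace ℝ (Fin 3)) :
    complexProdReal p = (⟨p 0, p 1⟩, p 2) := rfl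

theorem complexProdReal_mem_circleCone {p : EuclideanSpace ℝ (Fin 3)} (hp : 0 ≤ p 2) (x y : ℝ)
    {r : ℝ} (hr : 0 ≤ r) : complexProdReal p ∈ circleCone ⟨x, y⟩ r ↔
      (p 0 - p 2 * x) ^ 2 + (p 1 - p 2 * y) ^ 2 = (r * p 2) ^ 2 := by
  have h : complexProdReal p ∈ circleCone ⟨x, y⟩ r ↔
      ‖(⟨p 0, p 1⟩ : ℂ) - p 2 • ⟨x, y⟩‖ = r * p 2 := and_iff_right hp
  rw [h, ← sq_eq_sq₀ (norm_nonneg _) (mul_nonneg hr hp), Complex.sq_norm, Complex.normSq_apply]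
  simp only [Complex.sub_re, Complex.smul_re, Complex.sub_im, Complex.smul_im, smul_eq_mul, sq]

theorem exampleX2_eq_preimage (k : ℕ) : ExampleX2 k = complexProdReal ⁻¹'
    ({p | 0 ≤ p.2 ∧ ‖p.1‖ = peanutRadius k p} ∪ circleCone 1 (1 / 4) ∪
      circleCone (-1) (1 / 4)) := by
  ext p
  rcases lt_or_ge (p 2) 0 with hp | hp
  · exact iff_of_false (fun h => h.2.not_gt hp) (by rintro ((h | h) | h) <;> exact h.1.not_gt hp)
  have h1 : complexProdReal p ∈ {p : ℂ × ℝ | 0 ≤ p.2 ∧ ‖p.1‖ = peanutRadius k p} ↔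
      ‖(complexProdReal p).1‖ = peanutRadius k (complexProdReal p) := and_iff_right hp
  have h2 : ‖(complexProdReal p).1‖ ^ 4 = (p 0 ^ 2 + p 1 ^ 2) ^ 2 := by
    rw [show 4 = 2 * 2 by rfl, pow_mul, Complex.sq_norm, Complex.normSq_apply]
    simp only [complexProdReal_apply, sq]
  have h3 := complexProdReal_mem_circleCone hp 1 0 (show (0 : ℝ) ≤ 1 / 4 by norm_num)
  have h4 := complexProdReal_mem_circleCone hp (-1) 0 (show (0 : ℝ) ≤ 1 / 4 by norm_num)
  rw [show (⟨1, 0⟩ : ℂ) = 1 from rfl] at h3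
  rw [show (⟨-1, 0⟩ : ℂ) = -1 from Complex.ext (by simp) (by simp)] at h4
  rw [mem_preimage, mem_union, mem_union, h1, norm_eq_peanutRadius_iff hp, h2, h3, h4, ExampleX2,
    mem_ofPred_eq, and_iff_left hp, mul_eq_zero, mul_eq_zero]
  simp only [complexProdReal_apply]
  refine or_congr (or_congr ?_ ?_) ?_ <;> constructor <;> intro h <;> linear_combination h

theorem coneC_eq_preimage : ConeC = complexProdReal ⁻¹'
    (circleCone 0 2 ∪ circleCone ⟨1, 1 / 2⟩ (1 / 4) ∪ circleCone ⟨1, -1 / 2⟩ (1 / 4)) := by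
  ext p
  rcases lt_or_ge (p 2) 0 with hp | hp
  · exact iff_of_false (fun h => h.2.not_gt hp) (by rintro ((h | h) | h) <;> exact h.1.not_gt hp)
  have h1 := complexProdReal_mem_circleCone hp 0 0 (show (0 : ℝ) ≤ 2 by norm_num)
  rw [show (⟨0, 0⟩ : ℂ) = 0 from rfl] at h1
  rw [mem_preimage, mem_union, mem_union, h1, complexProdReal_mem_circleCone hp _ _ (by norm_num),
    complexProdReal_mem_circleCone hp _ _ (by norm_num), ConeC,
    mem_ofPred_eq, and_iff_left hp, mul_eq_zero, mul_eq_zero]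
  refine or_congr (or_congr ?_ ?_) ?_ <;> constructor <;> intro h <;> linear_combination h

theorem ambientTopEquiv_of_homeomorph {n : ℕ} {X Y : Set (EuclideanSpace ℝ (Fin n))}
    (H : EuclideanSpace ℝ (Fin n) ≃ₜ EuclideanSpace ℝ (Fin n)) (h0 : H 0 = 0) (hH : H '' X = Y) :
    AmbientTopEquiv X Y :=
  ⟨univ, univ, isOpen_univ, isOpen_univ, mem_univ _, mem_univ _, H, H.symm,
    H.continuous.continuousOn, H.symm.continuous.continuousOn, mapsTo_univ _ _, mapsTo_univ _ _,
    fun x _ => H.symm_apply_apply x, fun y _ => H.apply_symm_apply y, h0, by simpa using hH⟩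

/-- the germ at `0` of `X₂` is ambient topologically equivalent to the germ
at `0` of the straight cone `C` over three disjoint circles. -/
theorem example1_X2_top_equiv_cone (k : ℕ) (hk : 4 < k) :
    AmbientTopEquiv (ExampleX2 k) ConeC := by
  have hk0 : k ≠ 0 := by omega
  obtain ⟨G, hG0, hG, hG₁, hG₂⟩ := exists_homeomorph_move_circles
  let F := radialHomeomorph (isRadius_peanutRadius hk0) isRadius_coneRadius
  have hF0 : F 0 = 0 := radialMap_of_nonpos (isRadius_peanutRadius hk0) isRadius_coneRadius le_rfl
  have hF : F '' {p | 0 ≤ p.2 ∧ ‖p.1‖ = peanutRadius k p} = circleCone 0 2 := by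
    refine (radialHomeomorph_image _ _).trans ?_
    ext p
    refine and_congr_right fun hp => ?_
    rw [coneRadius, max_eq_left hp, smul_zero, sub_zero]
  have hF₁ : F '' circleCone 1 (1 / 4) = circleCone 1 (1 / 4) := by
    simpa using radialHomeomorph_image_inner hk0 (one_pow 2)
  have hF₂ : F '' circleCone (-1) (1 / 4) = circleCone (-1) (1 / 4) := by
    simpa using radialHomeomorph_image_inner hk0 (w := -1) (by norm_num)
  have he0 : complexProdReal 0 = 0 := rfl
  refine ambientTopEquiv_of_homeomorph
    (((complexProdReal.trans F).trans G).trans complexProdReal.symm) ?_ ?_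
  · simp only [Homeomorph.trans_apply, he0, hF0, hG0]
    rw [← he0, Homeomorph.symm_apply_apply]
  · have htrans (A : Set (EuclideanSpace ℝ (Fin 3))) :
        (((complexProdReal.trans F).trans G).trans complexProdReal.symm) '' A =
          complexProdReal.symm '' (G '' (F '' (complexProdReal '' A))) := by
      simp only [image_image]
      rfl
    rw [htrans, exampleX2_eq_preimage, coneC_eq_preimage,
      image_preimage_eq _ complexProdReal.surjective]
    simp only [image_union, hF, hF₁, hF₂, hG, hG₁, hG₂]
    simp only [complexProdReal.image_symm, preimage_union]
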